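/- Let B be an m×n dual quaternion matrix and A = B* B. Then there exists a unitary dual quaternion matrix U ∈ 𝔻ℚ^{n×n} (U* U = I_n) such that U* A U is a diagonal matrix whose diagonal entries are dual numbers, each of which is either zero or has positive real standard part (i.e., no diagonal entry is a nonzero infinitesimal dual number). -/

import Mathlib

open TrivSqZeroExt Matrix

/-- The quaternions. -/
abbrev HQ := Quaternion ℝ

/-- The dual quaternions: `q = q_st + q_I ε` with `ε² = 0`, `ε` commuting with quaternions. -/
abbrev DQ := DualNumber HQ

/-- Conjugation of a dual quaternion: `q* = q_st* + q_I* ε`. -/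
noncomputable instance : Star DQ :=
  ⟨fun q => inl (star (fst q)) + inr (star (snd q))⟩

/-- A dual quaternion is appreciable if its standard part is nonzero. -/
def DQ.Appreciable (q : DQ) : Prop := fst q ≠ 0

/-- A dual quaternion is a dual number if both parts are real. -/
def DQ.IsDualNum (q : DQ) : Prop := ∃ a b : ℝ, q = inl (a : HQ) + inr (b : HQ)

/-- The total order on dual numbers: `p ≤ q` iff `p_st < q_st`, or `p_st = q_st` and `p_I ≤ q_I`. -/
def DQ.le (p q : DQ) : Prop :=
  (fst p).re < (fst q).re ∨ ((fst p).re = (fst q).re ∧ (snd p).re ≤ (snd q).re)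

/-- The strict total order on dual numbers. -/
def DQ.lt (p q : DQ) : Prop :=
  (fst p).re < (fst q).re ∨ ((fst p).re = (fst q).re ∧ (snd p).re < (snd q).re)

/-- The scaled rotation `α • [[1, -z*], [z, 1]]` in the coordinate plane of `p` and `q`,
extended by the identity. -/
noncomputable def planeRotation {n : ℕ} (p q : Fin n) (α : ℝ) (z : HQ) :
    Matrix (Fin n) (Fin n) HQ :=
  Matrix.of fun i j =>
    if j = p then (Pi.single p (α : HQ) + Pi.single q ((α : HQ) * z) : Fin n → HQ) i
    else if j = q then (Pi.single q (α : HQ) + Pi.single p (-((α : HQ) * star z)) : Fin n → HQ) i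
    else (Pi.single j 1 : Fin n → HQ) i

/-- A conjugated matrix entry as a form evaluated at two columns. -/
lemma conjTranspose_mul_mul_apply {n : ℕ} (R H : Matrix (Fin n) (Fin n) HQ) (i j : Fin n) :
    (Rᴴ * H * R) i j = star (fun k => R k i) ⬝ᵥ (H *ᵥ fun k => R k j) := by
  rw [Matrix.mul_assoc, Matrix.mul_apply_eq_vecMul]
  simp only [Matrix.vecMul, dotProduct, Matrix.mulVec, Matrix.mul_apply,
    Matrix.conjTranspose_apply, Pi.star_apply]

lemma planeRotation_col_left {n : ℕ} (p q : Fin n) (α : ℝ) (z : HQ) :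
    (fun k => planeRotation p q α z k p) = Pi.single p (α : HQ) + Pi.single q ((α : HQ) * z) := by
  ext1 k
  simp [planeRotation]

lemma planeRotation_col_right {n : ℕ} {p q : Fin n} (hpq : p ≠ q) (α : ℝ) (z : HQ) :
    (fun k => planeRotation p q α z k q) =
      Pi.single q (α : HQ) + Pi.single p (-((α : HQ) * star z)) := by
  ext1 k
  simp [planeRotation, hpq.symm]

lemma planeRotation_col_of_ne {n : ℕ} {p q i : Fin n} (hp : i ≠ p) (hq : i ≠ q) (α : ℝ) (z : HQ) :
    (fun k => planeRotation p q α z k i) = Pi.single i 1 := by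
  ext1 k
  simp [planeRotation, hp, hq]

lemma coe_sq_add_normSq {α : ℝ} {z : HQ} (h : α ^ 2 * (1 + Quaternion.normSq z) = 1) :
    (α : HQ) * α + (α : HQ) * α * (star z * z) = 1 := by
  rw [Quaternion.star_mul_self]
  have h' : α * α + α * α * Quaternion.normSq z = 1 := by linear_combination h
  exact_mod_cast congrArg (fun r : ℝ => (r : HQ)) h'

lemma star_single_quaternion {n : ℕ} (a : Fin n) (x : HQ) :
    star (Pi.single a x : Fin n → HQ) = Pi.single a (star x) := by
  ext1 k
  by_cases h : k = a
  · subst h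
    simp
  · simp [h]

lemma planeRotation_unitary {n : ℕ} {p q : Fin n} (hpq : p ≠ q) {α : ℝ} {z : HQ}
    (h : α ^ 2 * (1 + Quaternion.normSq z) = 1) :
    (planeRotation p q α z)ᴴ * planeRotation p q α z = 1 := by
  have h1 := coe_sq_add_normSq h
  have hc : ∀ x : HQ, x * (α : HQ) = (α : HQ) * x := fun x => (Quaternion.coe_commutes α x).symm
  have h2 : (α : HQ) * α + (α : HQ) * α * (z * star z) = 1 := by
    rw [Quaternion.self_mul_star, ← Quaternion.star_mul_self]; exact h1
  ext1 i j
  have key := conjTranspose_mul_mul_apply (planeRotation p q α z) 1 i j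
  rw [Matrix.mul_one, Matrix.one_mulVec] at key
  rw [key]
  have hs := star_single_quaternion (n := n)
  by_cases hip : i = p
  · subst hip
    by_cases hjp : j = i
    · subst hjp
      rw [planeRotation_col_left]
      simp [star_add, hs, hpq, hpq.symm, dotProduct_add]
      rw [← h1, hc (star z)]; simp only [mul_assoc]; rw [← mul_assoc (star z), hc (star z)]
      simp only [mul_assoc]
    by_cases hjq : j = q
    · subst hjq
      rw [planeRotation_col_left, planeRotation_col_right hpq]
      simp [star_add, hs, hpq, hpq.symm, dotProduct_add, hc]
    · rw [planeRotation_col_left, planeRotation_col_of_ne hjp hjq]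
      simp [star_add, hs, hjp, hjq, Ne.symm hjp]
  by_cases hiq : i = q
  · subst hiq
    by_cases hjp : j = p
    · subst hjp
      rw [planeRotation_col_left, planeRotation_col_right hpq]
      simp [star_add, hs, hpq, hpq.symm, dotProduct_add, hc]
    by_cases hjq : j = i
    · subst hjq
      rw [planeRotation_col_right hpq]
      simp [star_add, hs, hpq, hpq.symm, dotProduct_add]
      rw [← h2, hc z]; simp only [mul_assoc]; rw [← mul_assoc z, hc z]
      simp only [mul_assoc]
    · rw [planeRotation_col_right hpq, planeRotation_col_of_ne hjp hjq]
      simp [star_add, hs, hjp, hjq, Ne.symm hjq]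
  · rw [planeRotation_col_of_ne hip hiq]
    by_cases hjp : j = p
    · subst hjp
      rw [planeRotation_col_left]
      simp [hs, hip, hiq, dotProduct_add]
    by_cases hjq : j = q
    · subst hjq
      rw [planeRotation_col_right hpq]
      simp [hs, hip, hiq, dotProduct_add]
    · rw [planeRotation_col_of_ne hjp hjq]
      by_cases hij : i = j
      · subst hij; simp [hs]
      · simp [hs, hij, Ne.symm hij]

lemma eq_coe_re_of_conjTranspose_eq {n : ℕ} {H : Matrix (Fin n) (Fin n) HQ} (hH : Hᴴ = H)
    (i : Fin n) : H i i = ((H i i).re : HQ) :=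
  Quaternion.star_eq_self.mp (congrFun (congrFun hH i) i)

/-- The weighted trace of `R* H R` for a plane rotation `R`. -/
lemma planeRotation_weighted_trace {n : ℕ} {p q : Fin n} (hpq : p ≠ q) {α : ℝ} {z : HQ}
    (h : α ^ 2 * (1 + Quaternion.normSq z) = 1) (w : Fin n → ℝ)
    {H : Matrix (Fin n) (Fin n) HQ} (hH : Hᴴ = H) :
    ∑ i, w i * (((planeRotation p q α z)ᴴ * H * planeRotation p q α z) i i).re =
      ∑ i, w i * (H i i).re + (w p - w q) * α ^ 2 *
        (Quaternion.normSq z * ((H q q).re - (H p p).re) + 2 * (H p q * z).re) := by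
  have hs := star_single_quaternion (n := n)
  have hreal := eq_coe_re_of_conjTranspose_eq hH
  have hqp : H q p = star (H p q) := (congrFun (congrFun hH q) p).symm
  have ep : (((planeRotation p q α z)ᴴ * H * planeRotation p q α z) p p).re =
      (H p p).re + α ^ 2 *
        (Quaternion.normSq z * ((H q q).re - (H p p).re) + 2 * (H p q * z).re) := by
    rw [conjTranspose_mul_mul_apply, planeRotation_col_left]
    simp [star_add, hs, add_dotProduct, Matrix.mulVec_add, hqp]
    rw [hreal p, hreal q]
    simp [Quaternion.normSq_def'] at h ⊢
    linear_combination (H p p).re * h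
  have eq : (((planeRotation p q α z)ᴴ * H * planeRotation p q α z) q q).re =
      (H q q).re - α ^ 2 *
        (Quaternion.normSq z * ((H q q).re - (H p p).re) + 2 * (H p q * z).re) := by
    rw [conjTranspose_mul_mul_apply, planeRotation_col_right hpq]
    simp [star_add, hs, add_dotProduct, Matrix.mulVec_add, hqp]
    rw [hreal p, hreal q]
    simp [Quaternion.normSq_def'] at h ⊢
    linear_combination (H q q).re * h
  have eo : ∀ i, i ≠ p → i ≠ q →
      (((planeRotation p q α z)ᴴ * H * planeRotation p q α z) i i).re = (H i i).re := by
    intro i hp hq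
    rw [conjTranspose_mul_mul_apply, planeRotation_col_of_ne hp hq]
    simp [hs]
  rw [← sub_eq_iff_eq_add', ← Finset.sum_sub_distrib,
    Finset.sum_eq_add p q hpq (fun i _ hi => by rw [eo i hi.1 hi.2, sub_self])
      (by simp) (by simp), ep, eq]
  ring

/-- The unitary quaternion matrices whose `(i, j)` entry vanishes unless `c i = c j`. -/
def blockUnitary {n : ℕ} (c : Fin n → ℝ) : Set (Matrix (Fin n) (Fin n) HQ) :=
  {V | Vᴴ * V = 1 ∧ ∀ i j, c i ≠ c j → V i j = 0}

lemma re_conjTranspose_mul_self_apply {m n : ℕ} (V : Matrix (Fin m) (Fin n) HQ) (j : Fin n) :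
    ((Vᴴ * V) j j).re = ∑ k, Quaternion.normSq (V k j) := by
  have h : (Vᴴ * V) j j = ((∑ k, Quaternion.normSq (V k j) : ℝ) : HQ) := by
    rw [Matrix.mul_apply, ← Quaternion.algebraMap_def, map_sum]
    exact Finset.sum_congr rfl fun k _ => Quaternion.star_mul_self _
  rw [h, Quaternion.re_coe]

lemma isCompact_blockUnitary {n : ℕ} (c : Fin n → ℝ) : IsCompact (blockUnitary c) := by
  have : ProperSpace HQ := FiniteDimensional.proper_real HQ
  have hK : IsCompact (Set.univ.pi fun _ : Fin n => Set.univ.pi fun _ : Fin n =>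
      Metric.closedBall (0 : HQ) 1) :=
    isCompact_univ_pi fun _ => isCompact_univ_pi fun _ => isCompact_closedBall _ _
  refine IsCompact.of_isClosed_subset hK ?_ ?_
  · refine IsClosed.inter (isClosed_eq (by fun_prop) continuous_const) ?_
    change IsClosed {V : Matrix (Fin n) (Fin n) HQ | ∀ i j, c i ≠ c j → V i j = 0}
    have e : {V : Matrix (Fin n) (Fin n) HQ | ∀ i j, c i ≠ c j → V i j = 0} =
        ⋂ (i) (j) (_ : c i ≠ c j), {V | V i j = 0} := by
      ext V
      simp
    rw [e]
    exact isClosed_iInter fun i => isClosed_iInter fun j => isClosed_iInter fun _ =>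
      isClosed_eq (continuous_id.matrix_elem i j) continuous_const
  · rintro V ⟨hV, -⟩ i - j -
    have h1 := re_conjTranspose_mul_self_apply V j
    rw [hV, Matrix.one_apply_eq, Quaternion.re_one] at h1
    have h2 : Quaternion.normSq (V i j) ≤ 1 := h1 ▸
      Finset.single_le_sum (f := fun k => Quaternion.normSq (V k j))
        (fun k _ => Quaternion.normSq_nonneg) (Finset.mem_univ i)
    rw [Quaternion.normSq_eq_norm_mul_self] at h2
    rw [mem_closedBall_zero_iff]
    nlinarith [norm_nonneg (V i j)]

/-- A Hermitian quaternion matrix becomes diagonal within each block of indices on which `c` is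
constant, after conjugation by a unitary matrix respecting these blocks. -/
lemma exists_blockUnitary_diagonalizing {n : ℕ} (c : Fin n → ℝ)
    {K : Matrix (Fin n) (Fin n) HQ} (hK : Kᴴ = K) :
    ∃ V ∈ blockUnitary c, ∀ i j, i ≠ j → c i = c j → (Vᴴ * K * V) i j = 0 := by
  have hne : (blockUnitary c).Nonempty :=
    ⟨1, by simp, fun i j h => Matrix.one_apply_ne fun e => h (e ▸ rfl)⟩
  have hcont : Continuous fun V : Matrix (Fin n) (Fin n) HQ =>
      ∑ i : Fin n, ((i : ℕ) : ℝ) * ((Vᴴ * K * V) i i).re := by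
    refine continuous_finsetSum _ fun i _ => continuous_const.mul
      (Quaternion.continuous_re.comp (Continuous.matrix_elem ?_ i i))
    fun_prop
  obtain ⟨V, ⟨hV1, hV2⟩, hmax⟩ := (isCompact_blockUnitary c).exists_isMaxOn hne hcont.continuousOn
  refine ⟨V, ⟨hV1, hV2⟩, fun p q hpq hc => ?_⟩
  by_contra hh
  set H := Vᴴ * K * V with hHdef
  have hH : Hᴴ = H := by
    simp [hHdef, Matrix.conjTranspose_mul, hK, Matrix.mul_assoc]
  have hpos : 0 < Quaternion.normSq (H p q) :=
    lt_of_le_of_ne Quaternion.normSq_nonneg fun e => hh (Quaternion.normSq_eq_zero.mp e.symm)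
  have hw : ((p : ℕ) : ℝ) - ((q : ℕ) : ℝ) ≠ 0 :=
    sub_ne_zero.mpr fun e => hpq (Fin.ext (Nat.cast_injective e))
  have key : ∀ t : ℝ, (((p : ℕ) : ℝ) - ((q : ℕ) : ℝ)) *
      (t * (2 + t * ((H q q).re - (H p p).re))) ≤ 0 := by
    intro t
    set z : HQ := (t : HQ) * star (H p q) with hz
    have hzn : Quaternion.normSq z = t ^ 2 * Quaternion.normSq (H p q) := by
      simp [hz, map_mul, Quaternion.normSq_coe]
    have hzr : (H p q * z).re = t * Quaternion.normSq (H p q) := by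
      rw [hz, ← mul_assoc, ← Quaternion.coe_commutes, mul_assoc, Quaternion.self_mul_star]
      simp
    have hs : 0 < 1 + Quaternion.normSq z := by
      have := Quaternion.normSq_nonneg (a := z)
      linarith
    set α : ℝ := (√(1 + Quaternion.normSq z))⁻¹ with hα
    have h1 : α ^ 2 * (1 + Quaternion.normSq z) = 1 := by
      rw [hα, inv_pow, Real.sq_sqrt hs.le, inv_mul_cancel₀ hs.ne']
    have hα0 : 0 < α ^ 2 := by positivity
    set R := planeRotation p q α z with hR
    have hmem : V * R ∈ blockUnitary c := by
      refine ⟨?_, fun i j hij => ?_⟩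
      · rw [Matrix.conjTranspose_mul, Matrix.mul_assoc, ← Matrix.mul_assoc Vᴴ, hV1,
          Matrix.one_mul, planeRotation_unitary hpq h1]
      · rw [Matrix.mul_apply]
        refine Finset.sum_eq_zero fun k _ => ?_
        by_cases hik : c i = c k
        · have hkj : c k ≠ c j := hik ▸ hij
          have hkp : R k j = 0 := by
            have a1 : k ≠ j := fun e => hkj (e ▸ rfl)
            by_cases jp : j = p
            · have : k ≠ q := fun e => hkj (by rw [e, jp, hc])
              subst jp
              simp [hR, planeRotation, a1, this]
            by_cases jq : j = q
            · have : k ≠ p := fun e => hkj (by rw [e, jq, hc])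
              subst jq
              simp [hR, planeRotation, a1, this, jp]
            · simp [hR, planeRotation, a1, jp, jq]
          rw [hkp, mul_zero]
        · rw [hV2 i k hik, zero_mul]
    have hle := hmax hmem
    simp only [Set.mem_ofPred_eq] at hle
    have e : (V * R)ᴴ * K * (V * R) = Rᴴ * H * R := by
      simp only [hHdef, Matrix.conjTranspose_mul, Matrix.mul_assoc]
    rw [e, hR, planeRotation_weighted_trace hpq h1 (fun i => ((i : ℕ) : ℝ)) hH, hzn, hzr] at hle
    have h3 : α ^ 2 * Quaternion.normSq (H p q) * ((((p : ℕ) : ℝ) - ((q : ℕ) : ℝ)) *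
      (t * (2 + t * ((H q q).re - (H p p).re)))) ≤ 0 := by linarith
    exact nonpos_of_mul_nonpos_right h3 (by positivity)
  set a := (H q q).re - (H p p).re
  set t : ℝ := (1 + |a|)⁻¹
  have ht : 0 < t := by positivity
  have hta : |t * a| ≤ 1 := by
    rw [abs_mul, abs_of_pos ht, inv_mul_le_iff₀ (by positivity)]
    linarith
  obtain ⟨l, r⟩ := abs_le.mp hta
  rcases lt_or_gt_of_ne hw with hneg | hpos'
  · have := key (-t)
    have h4 : 0 < t * (2 - t * a) := mul_pos ht (by linarith)
    nlinarith
  · have := key t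
    have h4 : 0 < t * (2 + t * a) := mul_pos ht (by linarith)
    nlinarith

lemma DQ.fst_star (q : DQ) : fst (star q) = star (fst q) := by
  change fst (inl (star (fst q)) + inr (star (snd q))) = _
  simp

lemma DQ.snd_star (q : DQ) : snd (star q) = star (snd q) := by
  change snd (inl (star (fst q)) + inr (star (snd q))) = _
  simp

lemma DQ.map_fst_conjTranspose {m n : ℕ} (M : Matrix (Fin m) (Fin n) DQ) :
    Mᴴ.map fst = (M.map fst)ᴴ := by
  ext1 i j
  exact DQ.fst_star _

lemma DQ.map_snd_conjTranspose {m n : ℕ} (M : Matrix (Fin m) (Fin n) DQ) :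
    Mᴴ.map snd = (M.map snd)ᴴ := by
  ext1 i j
  exact DQ.snd_star _

lemma DQ.map_fst_mul {l m n : ℕ} (M : Matrix (Fin l) (Fin m) DQ) (N : Matrix (Fin m) (Fin n) DQ) :
    (M * N).map fst = M.map fst * N.map fst := by
  ext1 i j
  simp [Matrix.mul_apply, TrivSqZeroExt.fst_sum]

lemma DQ.map_snd_mul {l m n : ℕ} (M : Matrix (Fin l) (Fin m) DQ) (N : Matrix (Fin m) (Fin n) DQ) :
    (M * N).map snd = M.map fst * N.map snd + M.map snd * N.map fst := by
  ext1 i j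
  simp [Matrix.mul_apply, TrivSqZeroExt.snd_sum, Finset.sum_add_distrib]

lemma DQ.matrix_ext {m n : ℕ} {M N : Matrix (Fin m) (Fin n) DQ}
    (h0 : M.map fst = N.map fst) (h1 : M.map snd = N.map snd) : M = N := by
  ext1 i j
  exact TrivSqZeroExt.ext (congrFun (congrFun h0 i) j) (congrFun (congrFun h1 i) j)

/-- For a quaternion matrix pair `(B₀, B₁)` there is a unitary `Q` diagonalizing `B₀* B₀` with real
eigenvalues `μ`, such that the Hermitian matrix `(B₀ Q)* (B₁ Q) + (B₁ Q)* (B₀ Q)` is diagonal on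
each eigenspace. -/
lemma exists_unitary_diagonalizing_pair {m n : ℕ} (B₀ B₁ : Matrix (Fin m) (Fin n) HQ) :
    ∃ (Q : Matrix (Fin n) (Fin n) HQ) (μ : Fin n → ℝ), Qᴴ * Q = 1 ∧
      (B₀ * Q)ᴴ * (B₀ * Q) = Matrix.diagonal (fun i => (μ i : HQ)) ∧
      ∀ i j, i ≠ j → μ i = μ j →
        ((B₀ * Q)ᴴ * (B₁ * Q) + (B₁ * Q)ᴴ * (B₀ * Q)) i j = 0 := by
  obtain ⟨W, ⟨hW, -⟩, hWd⟩ := exists_blockUnitary_diagonalizing (fun _ : Fin n => (0 : ℝ))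
    (K := B₀ᴴ * B₀) (by simp [Matrix.conjTranspose_mul])
  set μ : Fin n → ℝ := fun i => ((Wᴴ * (B₀ᴴ * B₀) * W) i i).re with hμ
  have hD : Wᴴ * (B₀ᴴ * B₀) * W = Matrix.diagonal (fun i => (μ i : HQ)) := by
    ext1 i j
    by_cases hij : i = j
    · subst hij
      rw [Matrix.diagonal_apply_eq]
      exact eq_coe_re_of_conjTranspose_eq
        (by simp [Matrix.conjTranspose_mul, Matrix.mul_assoc]) i
    · rw [Matrix.diagonal_apply_ne _ hij, hWd i j hij rfl]
  obtain ⟨V, ⟨hV, hVc⟩, hVd⟩ := exists_blockUnitary_diagonalizing μ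
    (K := (B₀ * W)ᴴ * (B₁ * W) + (B₁ * W)ᴴ * (B₀ * W))
    (by simp [Matrix.conjTranspose_mul, Matrix.mul_assoc, add_comm])
  have hcomm : Matrix.diagonal (fun i => (μ i : HQ)) * V =
      V * Matrix.diagonal (fun i => (μ i : HQ)) := by
    ext1 i j
    rw [Matrix.diagonal_mul, Matrix.mul_diagonal]
    by_cases hij : μ i = μ j
    · rw [hij, Quaternion.coe_commutes]
    · rw [hVc i j hij, mul_zero, zero_mul]
  refine ⟨W * V, μ, ?_, ?_, fun i j hij hc => ?_⟩
  · rw [Matrix.conjTranspose_mul, Matrix.mul_assoc, ← Matrix.mul_assoc Wᴴ, hW, Matrix.one_mul, hV]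
  · calc (B₀ * (W * V))ᴴ * (B₀ * (W * V)) = Vᴴ * ((Wᴴ * (B₀ᴴ * B₀) * W) * V) := by
          simp only [Matrix.conjTranspose_mul, Matrix.mul_assoc]
      _ = _ := by rw [hD, hcomm, ← Matrix.mul_assoc, hV, Matrix.one_mul]
  · rw [← hVd i j hij hc]
    simp only [Matrix.conjTranspose_mul, Matrix.mul_assoc, Matrix.mul_add, Matrix.add_mul]

/-- For `A = B* B` with `B` an `m × n` dual quaternion matrix, there is a unitary `U` such
that `U* A U` is diagonal with dual number entries, each of which is either zero or has
positive real standard part (no nonzero infinitesimal diagonal entries). -/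
theorem gram_matrix_unitary_diagonalization {m n : ℕ}
    (B : Matrix (Fin m) (Fin n) DQ) :
    ∃ (U : Matrix (Fin n) (Fin n) DQ) (d : Fin n → DQ),
      Uᴴ * U = 1 ∧
      (∀ i, DQ.IsDualNum (d i)) ∧
      Uᴴ * (Bᴴ * B) * U = Matrix.diagonal d ∧
      (∀ i, d i = 0 ∨ 0 < (fst (d i)).re) := by
  obtain ⟨Q, μ, hQ, hG, hH0⟩ := exists_unitary_diagonalizing_pair (B.map fst) (B.map snd)
  set G₀ := B.map fst * Q
  set G₁ := B.map snd * Q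
  set H := G₀ᴴ * G₁ + G₁ᴴ * G₀ with hHdef
  have hH : Hᴴ = H := by
    simp [hHdef, Matrix.conjTranspose_mul, add_comm]
  set P : Matrix (Fin n) (Fin n) HQ := Matrix.of fun i j => ((μ j - μ i)⁻¹ : ℝ) * H i j with hP
  have hPs : Pᴴ = -P := by
    ext1 i j
    have hij : star (H j i) = H i j := congrFun (congrFun hH i) j
    simp only [hP, Matrix.conjTranspose_apply, Matrix.of_apply, Matrix.neg_apply, star_mul, hij,
      Quaternion.star_coe]
    rw [← Quaternion.coe_commutes, ← neg_mul, ← Quaternion.coe_neg, ← inv_neg, neg_sub]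
  set U : Matrix (Fin n) (Fin n) DQ := Matrix.of fun i j => inl (Q i j) + inr ((Q * P) i j) with hU
  have hU0 : U.map fst = Q := by
    ext1 i j
    simp [hU]
  have hU1 : U.map snd = Q * P := by
    ext1 i j
    simp [hU]
  have hBU0 : (B * U).map fst = G₀ := by rw [DQ.map_fst_mul, hU0]
  have hBU1 : (B * U).map snd = G₀ * P + G₁ := by
    rw [DQ.map_snd_mul, hU0, hU1, ← Matrix.mul_assoc]
  have hA : Uᴴ * (Bᴴ * B) * U = (B * U)ᴴ * (B * U) := by
    apply DQ.matrix_ext <;>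
    simp only [DQ.map_fst_mul, DQ.map_snd_mul, DQ.map_fst_conjTranspose, DQ.map_snd_conjTranspose,
      Matrix.conjTranspose_mul, Matrix.conjTranspose_add, Matrix.mul_assoc, Matrix.mul_add,
      Matrix.add_mul]
    abel
  have hμ : ∀ i, μ i = ∑ k, Quaternion.normSq (G₀ k i) := fun i => by
    rw [← re_conjTranspose_mul_self_apply, hG, Matrix.diagonal_apply_eq, Quaternion.re_coe]
  refine ⟨U, fun i => inl (μ i : HQ) + inr ((H i i).re : HQ), ?_, fun i => ⟨_, _, rfl⟩, ?_,
    fun i => ?_⟩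
  · apply DQ.matrix_ext
    · rw [DQ.map_fst_mul, DQ.map_fst_conjTranspose, hU0, hQ]
      ext1 i j
      by_cases hij : i = j <;> simp [hij, Matrix.one_apply]
    · rw [DQ.map_snd_mul, DQ.map_fst_conjTranspose, DQ.map_snd_conjTranspose, hU0, hU1,
        Matrix.conjTranspose_mul, Matrix.mul_assoc, hQ, ← Matrix.mul_assoc, hQ, hPs]
      ext1 i j
      by_cases hij : i = j <;> simp [hij]
  · rw [hA]
    apply DQ.matrix_ext
    · rw [DQ.map_fst_mul, DQ.map_fst_conjTranspose, hBU0, hG]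
      ext1 i j
      by_cases hij : i = j
      · subst hij; simp
      · simp [hij]
    · have e : G₀ᴴ * (G₀ * P + G₁) + (G₀ * P + G₁)ᴴ * G₀ =
          H + (G₀ᴴ * G₀) * P - P * (G₀ᴴ * G₀) := by
        rw [Matrix.conjTranspose_add, Matrix.conjTranspose_mul G₀ P, hPs, hHdef]
        simp only [Matrix.mul_add, Matrix.add_mul, Matrix.mul_assoc, Matrix.neg_mul]
        abel
      rw [DQ.map_snd_mul, DQ.map_fst_conjTranspose, DQ.map_snd_conjTranspose, hBU0, hBU1, e, hG]
      ext1 i j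
      rw [Matrix.sub_apply, Matrix.add_apply, Matrix.diagonal_mul, Matrix.mul_diagonal,
        ← Quaternion.coe_commutes, add_sub_assoc, ← sub_mul, ← Quaternion.coe_sub]
      by_cases hij : i = j
      · subst hij
        simpa using eq_coe_re_of_conjTranspose_eq hH i
      · simp only [Matrix.map_apply, Matrix.diagonal_apply_ne _ hij, snd_zero]
        by_cases hc : μ i = μ j
        · rw [hc, sub_self, Quaternion.coe_zero, zero_mul, add_zero, hH0 i j hij hc]
        · have hne : μ j - μ i ≠ 0 := sub_ne_zero.mpr (Ne.symm hc)
          rw [hP, Matrix.of_apply, ← mul_assoc, ← Quaternion.coe_mul, ← neg_sub (μ j), neg_mul,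
            mul_inv_cancel₀ hne]
          simp
  · have hnn : 0 ≤ μ i := hμ i ▸ Finset.sum_nonneg fun k _ => Quaternion.normSq_nonneg
    rcases hnn.eq_or_lt with h0 | hpos
    · left
      have hz : ∀ k, G₀ k i = 0 := fun k => Quaternion.normSq_eq_zero.mp
        ((Finset.sum_eq_zero_iff_of_nonneg fun k _ => Quaternion.normSq_nonneg).mp
          ((hμ i).symm.trans h0.symm) k (Finset.mem_univ k))
      have hHi : (H i i).re = 0 := by
        have h : H i i = 0 := by simp [hHdef, Matrix.mul_apply, hz]
        rw [h, Quaternion.re_zero]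
      simp [hHi, ← h0]
    · right
      simpa using hpos
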